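/- arXiv:2207.03362 — 11 statements merged into one kernel-verified Lean document; each statement's English description precedes it below -/
import Mathlib

section
/- Let G be a group and let A ≤ G be a subgroup. If every finite index subgroup of A is separable in G, then every subset of A which is separable in A is also separable in G. -/
open Pointwise

/-- A subset `Z` of a group `G` is separable (closed in the profinite topology on `G`):
for every `g ∉ Z` there is a finite index normal subgroup `N` of `G` with `g ∉ ZN`. -/
def SepSubset {G : Type*} [Group G] (Z : Set G) : Prop :=
  ∀ g ∉ Z, ∃ N : Subgroup G, N.Normal ∧ N.FiniteIndex ∧ g ∉ Z * (N : Set G)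

/-- If every finite index subgroup of `A ≤ G` is separable in `G`, then the profinite topology of
`G` induces the full profinite topology on `A`. -/
theorem exists_normal_finiteIndex_inter_subset {G : Type*} [Group G] (A : Subgroup G)
    (hfi : ∀ B : Subgroup A, B.FiniteIndex →
      SepSubset ((fun a : A => (a : G)) '' (B : Set A)))
    (K : Subgroup A) (hK : K.Normal) (hKfi : K.FiniteIndex) :
    ∃ N : Subgroup G, N.Normal ∧ N.FiniteIndex ∧ ∀ a : A, (a : G) ∈ N → a ∈ K := by
  have hsep : ∀ q : A ⧸ K, ∃ M : Subgroup G, M.Normal ∧ M.FiniteIndex ∧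
      (q.out ∉ K → (q.out : G) ∉ ((fun a : A => (a : G)) '' (K : Set A)) * (M : Set G)) := by
    intro q
    by_cases hq : q.out ∈ K
    · exact ⟨⊤, inferInstance, inferInstance, fun h => absurd hq h⟩
    · obtain ⟨M, hM, hMfi, hqM⟩ := hfi K hKfi (q.out : G) (by simpa using hq)
      exact ⟨M, hM, hMfi, fun _ => hqM⟩
  choose M hM hMfi hqM using hsep
  refine ⟨⨅ q, M q, Subgroup.normal_iInf_normal hM, Subgroup.finiteIndex_iInf hMfi, ?_⟩
  intro a ha
  by_contra haK
  obtain ⟨b, hb⟩ := QuotientGroup.mk_out_eq_mul K a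
  apply hqM (a : A ⧸ K)
  · rw [hb, K.mul_mem_cancel_right b.2]
    exact haK
  · refine ⟨_, ⟨a * b * a⁻¹, hK.conj_mem _ b.2 a, rfl⟩, a, Subgroup.mem_iInf.1 ha _, ?_⟩
    simp [hb]

/-- If every finite index subgroup of `A ≤ G` is separable in `G`, then every subset of `A`
that is separable in `A` is separable in `G`. -/
theorem stmt_1 {G : Type*} [Group G] (A : Subgroup G)
    (hfi : ∀ B : Subgroup A, B.FiniteIndex →
      SepSubset ((fun a : A => (a : G)) '' (B : Set A)))
    (Z : Set A) (hZ : SepSubset Z) :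
    SepSubset ((fun a : A => (a : G)) '' Z) := by
  intro g hg
  by_cases hgA : g ∈ A
  · obtain ⟨K, hK, hKfi, hgK⟩ := hZ ⟨g, hgA⟩ fun h => hg ⟨_, h, rfl⟩
    obtain ⟨N, hN, hNfi, hNK⟩ := exists_normal_finiteIndex_inter_subset A hfi K hK hKfi
    refine ⟨N, hN, hNfi, ?_⟩
    rintro ⟨_, ⟨z, hz, rfl⟩, n, hn, hzn⟩
    refine hgK ⟨z, hz, z⁻¹ * ⟨g, hgA⟩, hNK _ ?_, by simp⟩
    simpa [← hzn] using hn
  · obtain ⟨N, hN, hNfi, hgN⟩ := hfi ⊤ inferInstance g (by simpa using hgA)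
    exact ⟨N, hN, hNfi, fun h =>
      hgN (Set.mul_subset_mul_right (Set.image_mono (Set.subset_univ Z)) h)⟩
end

section
/- Let G be a group with subgroups A, B ≤ G. Suppose A' ≤ A and B' ≤ B are subgroups of finite index in A and B respectively, and that the product A'B' is separable in G. Then the product AB is separable in G. -/
open Pointwise

/-- If `A' ≤_f A`, `B' ≤_f B` and `A'B'` is separable in `G`, then `AB` is separable in `G`. -/
theorem stmt_2 {G : Type*} [Group G] (A B A' B' : Subgroup G)
    (hA' : A' ≤ A) (hB' : B' ≤ B)
    (hAfi : (A'.subgroupOf A).FiniteIndex) (hBfi : (B'.subgroupOf B).FiniteIndex)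
    (hsep : SepSubset ((A' : Set G) * (B' : Set G))) :
    SepSubset ((A : Set G) * (B : Set G)) := by
  intro g hg
  -- `r` and `s` are finite systems of left coset representatives.
  let r (i : A ⧸ A'.subgroupOf A) : A := i.out
  let s (j : B ⧸ B'.subgroupOf B) : B := j.out
  have hr (a : A) : ((r a : G))⁻¹ * a ∈ A' :=
    Subgroup.mem_subgroupOf.mp (QuotientGroup.eq.mp (QuotientGroup.out_eq' (a : A ⧸ A'.subgroupOf A)))
  have hs (b : B) : ((s b : G))⁻¹ * b ∈ B' :=
    Subgroup.mem_subgroupOf.mp (QuotientGroup.eq.mp (QuotientGroup.out_eq' (b : B ⧸ B'.subgroupOf B)))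
  have hg' (p : (A ⧸ A'.subgroupOf A) × (B ⧸ B'.subgroupOf B)) :
      (r p.1 : G)⁻¹ * g * s p.2 ∉ (A' : Set G) * (B' : Set G) := by
    rintro ⟨a, ha, b, hb, hab⟩
    refine hg ⟨r p.1 * a, A.mul_mem (r p.1).2 (hA' ha), b * (s p.2 : G)⁻¹,
      B.mul_mem (hB' hb) (B.inv_mem (s p.2).2), ?_⟩
    calc (r p.1 : G) * a * (b * (s p.2 : G)⁻¹) = r p.1 * (a * b) * (s p.2 : G)⁻¹ := by group
      _ = r p.1 * ((r p.1 : G)⁻¹ * g * s p.2) * (s p.2 : G)⁻¹ := by rw [← hab]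
      _ = g := by group
  choose N hN hNfi hgN using fun p => hsep _ (hg' p)
  refine ⟨⨅ p, N p, Subgroup.normal_iInf_normal hN, Subgroup.finiteIndex_iInf hNfi, ?_⟩
  rintro ⟨_, ⟨a, ha, b, hb, rfl⟩, n, hn, rfl⟩
  let p : (A ⧸ A'.subgroupOf A) × (B ⧸ B'.subgroupOf B) :=
    (((⟨a, ha⟩ : A) : A ⧸ _), (((⟨b, hb⟩ : B)⁻¹ : B) : B ⧸ _))
  have hb' : b * s p.2 ∈ B' := by
    simpa [p] using B'.inv_mem (hs (⟨b, hb⟩ : B)⁻¹)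
  have hn' : (s p.2 : G)⁻¹ * n * s p.2 ∈ N p := by
    simpa using (hN p).conj_mem n (Subgroup.mem_iInf.mp hn p) (s p.2 : G)⁻¹
  refine hgN p ⟨_, ⟨_, hr ⟨a, ha⟩, _, hb', rfl⟩, _, hn', ?_⟩
  simp only [p]
  group
end

section
/- Let G be a group and let A, B ≤ G be subgroups such that the intersection A ∩ B has finite index in A. If B is separable in G, then both products AB and BA are separable in G. -/
open Pointwise

/-- The pointwise inverse of a separable subset is separable. -/
theorem SepSubset.inv {G : Type*} [Group G] {Z : Set G} (hZ : SepSubset Z) :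
    SepSubset Z⁻¹ := by
  intro g hg
  obtain ⟨N, hN, hfin, hgN⟩ := hZ g⁻¹ (by simpa using hg)
  refine ⟨N, hN, hfin, ?_⟩
  rintro ⟨z, hz, n, hn, rfl⟩
  refine hgN ⟨z⁻¹, hz, z * n⁻¹ * z⁻¹, hN.conj_mem _ (N.inv_mem hn) z, ?_⟩
  simp [mul_assoc]

/-- If `A ∩ B` has finite index in `A` and `B` is separable, then `AB` is separable, being a
finite union of left translates of `B`. -/
theorem SepSubset.subgroup_mul {G : Type*} [Group G] (A B : Subgroup G)
    (hfi : ((A ⊓ B).subgroupOf A).FiniteIndex) (hsep : SepSubset (B : Set G)) :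
    SepSubset ((A : Set G) * (B : Set G)) := by
  intro g hg
  have hout : ∀ q : A ⧸ (A ⊓ B).subgroupOf A, ((q.out : A) : G)⁻¹ * g ∉ (B : Set G) :=
    fun q hq => hg ⟨q.out, q.out.2, _, hq, mul_inv_cancel_left _ _⟩
  choose N hN hfin hgN using fun q => hsep _ (hout q)
  refine ⟨⨅ q, N q, Subgroup.normal_iInf_normal hN, Subgroup.finiteIndex_iInf hfin, ?_⟩
  rintro ⟨_, ⟨a, ha, b, hb, rfl⟩, n, hn, rfl⟩
  obtain ⟨q, hq⟩ : ∃ q, q = (QuotientGroup.mk ⟨a, ha⟩ : A ⧸ (A ⊓ B).subgroupOf A) := ⟨_, rfl⟩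
  have hmem : ((q.out : A) : G)⁻¹ * a ∈ B := by
    have h := QuotientGroup.eq.mp ((QuotientGroup.out_eq' q).trans hq)
    exact (Subgroup.mem_subgroupOf.mp h).2
  refine hgN q ⟨_, B.mul_mem hmem hb, n, Subgroup.mem_iInf.mp hn q, ?_⟩
  simp [mul_assoc]

/-- If `A ∩ B` has finite index in `A` and `B` is separable in `G`, then the products
`AB` and `BA` are separable in `G`. -/
theorem stmt_3 {G : Type*} [Group G] (A B : Subgroup G)
    (hfi : ((A ⊓ B).subgroupOf A).FiniteIndex)
    (hsep : SepSubset (B : Set G)) :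
    SepSubset ((A : Set G) * (B : Set G)) ∧ SepSubset ((B : Set G) * (A : Set G)) := by
  have hAB := SepSubset.subgroup_mul A B hfi hsep
  refine ⟨hAB, ?_⟩
  simpa [mul_inv_rev] using hAB.inv
end

section
/- Let G be a group generated by a finite subset X, let P ≤ G be a subgroup, and let Z ⊆ P be a subset which is separable in P. Then for every constant C ≥ 0 there exists a finite index normal subgroup N of P such that every element of ZN ∖ Z has word length at least C with respect to X. -/
open Pointwise

/-- The word length of `g` with respect to a generating set `X`: the least `n` such that
`g` is a product of `n` elements of `X ∪ X⁻¹`. -/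
noncomputable def wordLength {G : Type*} [Group G] (X : Set G) (g : G) : ℕ :=
  sInf {n : ℕ | ∃ l : List G, l.length = n ∧ (∀ x ∈ l, x ∈ X ∪ X⁻¹) ∧ l.prod = g}

/-- In a group generated by `X`, every element is the product of a word in `X ∪ X⁻¹` whose length
is the word length of the element. -/
theorem exists_list_length_eq_wordLength {G : Type*} [Group G] {X : Set G}
    (hX : Subgroup.closure X = ⊤) (g : G) :
    ∃ l : List G, l.length = wordLength X g ∧ (∀ x ∈ l, x ∈ X ∪ X⁻¹) ∧ l.prod = g := by
  have hg : g ∈ Submonoid.closure (X ∪ X⁻¹) := by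
    rw [← Subgroup.closure_toSubmonoid, hX]
    exact Subgroup.mem_top g
  obtain ⟨l, hl, hprod⟩ := Submonoid.exists_list_of_mem_closure hg
  exact Nat.sInf_mem
    (s := {n : ℕ | ∃ l : List G, l.length = n ∧ (∀ x ∈ l, x ∈ X ∪ X⁻¹) ∧ l.prod = g})
    ⟨l.length, l, rfl, hl, hprod⟩

/-- Balls of a group with respect to a finite generating set are finite. -/
theorem finite_setOf_wordLength_lt {G : Type*} [Group G] {X : Set G} (hXfin : X.Finite)
    (hX : Subgroup.closure X = ⊤) (n : ℕ) : {g : G | wordLength X g < n}.Finite := by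
  have : Finite ↥(X ∪ X⁻¹) := (hXfin.union hXfin.inv).to_subtype
  refine ((List.finite_length_lt ↥(X ∪ X⁻¹) n).image
    fun l => (l.map Subtype.val).prod).subset fun g hg => ?_
  obtain ⟨l, hlen, hl, hprod⟩ := exists_list_length_eq_wordLength hX g
  lift l to List ↥(X ∪ X⁻¹) using hl
  rw [List.length_map] at hlen
  exact ⟨l, hlen.trans_lt hg, hprod⟩

/-- A separable subset can be separated from a finite set disjoint from it by a single finite index
normal subgroup. -/
theorem SepSubset.exists_forall_notMem {G : Type*} [Group G] {Z : Set G} (hZ : SepSubset Z)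
    {F : Set G} (hF : F.Finite) (hFZ : ∀ g ∈ F, g ∉ Z) :
    ∃ N : Subgroup G, N.Normal ∧ N.FiniteIndex ∧ ∀ g ∈ F, g ∉ Z * (N : Set G) := by
  have : Finite F := hF.to_subtype
  choose N hNormal hIndex hN using fun g : F => hZ g (hFZ g g.2)
  exact ⟨⨅ g, N g, Subgroup.normal_iInf_normal hNormal, Subgroup.finiteIndex_iInf hIndex,
    fun g hg hgZ => hN ⟨g, hg⟩ (Set.mul_subset_mul_left (iInf_le N ⟨g, hg⟩) hgZ)⟩

/-- If `Z ⊆ P ≤ G` is separable in `P`, then for every `C ≥ 0` there is a finite index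
normal subgroup `N` of `P` such that every element of `ZN ∖ Z` has `X`-length at least `C`. -/
theorem stmt_5 {G : Type*} [Group G] (X : Set G) (hXfin : X.Finite)
    (hXgen : Subgroup.closure X = ⊤) (P : Subgroup G) (Z : Set P)
    (hZ : SepSubset Z) (C : ℝ) (hC : 0 ≤ C) :
    ∃ N : Subgroup P, N.Normal ∧ N.FiniteIndex ∧
      ∀ g ∈ (Z * (N : Set P)) \ Z, C ≤ (wordLength X (g : G) : ℝ) := by
  have hF : {g : P | wordLength X (g : G) < ⌈C⌉₊ ∧ g ∉ Z}.Finite :=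
    ((finite_setOf_wordLength_lt hXfin hXgen ⌈C⌉₊).preimage
      Subtype.val_injective.injOn).subset fun _ hg => hg.1
  obtain ⟨N, hNormal, hIndex, hN⟩ := hZ.exists_forall_notMem hF fun _ hg => hg.2
  refine ⟨N, hNormal, hIndex, fun g hg => ?_⟩
  by_contra! hlt
  exact hN g ⟨Nat.lt_ceil.mpr hlt, hg.2⟩ hg.1
end

section
/- Let G be a group generated by a finite subset X, let P ≤ G be a subgroup, and let Z ⊆ P be a subset which is separable in P. Then for every finite subset A ⊆ P and every constant C ≥ 0 there exists a finite index normal subgroup N of P such that for all a ∈ A, every element of aZN ∖ aZ has word length at least C with respect to X. -/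
open Pointwise

/-- A separable set can be separated from finitely many points outside of it by a single
finite index normal subgroup. -/
theorem SepSubset.exists_normal_of_finite {G : Type*} [Group G] {Z : Set G} (hZ : SepSubset Z)
    {S : Set G} (hS : S.Finite) (hSZ : ∀ s ∈ S, s ∉ Z) :
    ∃ N : Subgroup G, N.Normal ∧ N.FiniteIndex ∧ ∀ s ∈ S, s ∉ Z * (N : Set G) := by
  have := hS.to_subtype
  choose N hN hfin hsep using fun s : S => hZ s (hSZ s s.2)
  refine ⟨⨅ s, N s, Subgroup.normal_iInf_normal hN, Subgroup.finiteIndex_iInf hfin,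
    fun s hs hmem => hsep ⟨s, hs⟩ ?_⟩
  exact Set.mul_subset_mul_left (SetLike.coe_subset_coe.2 (iInf_le N ⟨s, hs⟩)) hmem

/-- If `Z ⊆ P ≤ G` is separable in `P`, then for every finite subset `A ⊆ P` and every
`C ≥ 0` there is a finite index normal subgroup `N` of `P` such that for all `a ∈ A`,
every element of `aZN ∖ aZ` has `X`-length at least `C`. -/
theorem stmt_6 {G : Type*} [Group G] (X : Set G) (hXfin : X.Finite)
    (hXgen : Subgroup.closure X = ⊤) (P : Subgroup G) (Z : Set P)
    (hZ : SepSubset Z) (A : Set P) (hA : A.Finite) (C : ℝ) (hC : 0 ≤ C) :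
    ∃ N : Subgroup P, N.Normal ∧ N.FiniteIndex ∧
      ∀ a ∈ A, ∀ g ∈ (({a} : Set P) * Z * (N : Set P)) \ (({a} : Set P) * Z),
        C ≤ (wordLength X (g : G) : ℝ) := by
  have hball : {g : P | wordLength X (g : G) < ⌈C⌉₊}.Finite :=
    (finite_setOf_wordLength_lt hXfin hXgen ⌈C⌉₊).preimage Subtype.val_injective.injOn
  obtain ⟨N, hN, hfin, hsep⟩ := hZ.exists_normal_of_finite
    ((hA.inv.mul hball).sdiff (t := Z)) fun s hs => hs.2
  refine ⟨N, hN, hfin, fun a ha g hg => ?_⟩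
  by_contra! hlt
  obtain ⟨hmem, hnot⟩ := hg
  rw [mul_assoc] at hmem
  rw [Set.singleton_mul, Set.image_mul_left, Set.mem_preimage] at hmem hnot
  exact hsep (a⁻¹ * g)
    ⟨Set.mul_mem_mul (Set.inv_mem_inv.2 ha) (Nat.lt_ceil.2 hlt), hnot⟩ hmem
end

section
/- Let G be a group with subgroups K ≤ H ≤ G such that K has finite index in H. If K is separable in G, then there exists a finite index subgroup L ≤_f G such that L ∩ H = K. -/
open Pointwise

/-- If `K ≤_f H ≤ G` and `K` is separable in `G`, then there is `L ≤_f G` with `L ∩ H = K`. -/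
theorem stmt_7 {G : Type*} [Group G] (K H : Subgroup G) (hKH : K ≤ H)
    (hfi : (K.subgroupOf H).FiniteIndex) (hsep : SepSubset (K : Set G)) :
    ∃ L : Subgroup G, L.FiniteIndex ∧ L ⊓ H = K := by
  have separate (g : G) :
      ∃ M : Subgroup G, M.FiniteIndex ∧ K ≤ M ∧ (g ∈ M → g ∈ K) := by
    by_cases hg : g ∈ K
    · exact ⟨⊤, inferInstance, le_top, fun _ => hg⟩
    · obtain ⟨N, hN, hNfi, hgN⟩ := hsep g hg
      refine ⟨K ⊔ N, Subgroup.finiteIndex_of_le le_sup_right, le_sup_left, fun h => ?_⟩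
      rw [← Subgroup.mul_normal] at hgN
      exact absurd h hgN
  choose M hMfi hKM hM using separate
  refine ⟨⨅ q : H ⧸ K.subgroupOf H, M (q.out : H), Subgroup.finiteIndex_iInf fun q => hMfi _,
    le_antisymm ?_ (le_inf (le_iInf fun q => hKM _) hKH)⟩
  rintro h ⟨hL, hH⟩
  obtain ⟨k, hk⟩ := QuotientGroup.mk_out_eq_mul (K.subgroupOf H) ⟨h, hH⟩
  have hkK : ((k : H) : G) ∈ K := Subgroup.mem_subgroupOf.mp k.2
  have hL' := Subgroup.mem_iInf.mp hL (QuotientGroup.mk ⟨h, hH⟩)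
  have hout := hM _ (by
    have := mul_mem hL' (hKM _ hkK)
    rwa [show h * ((k : H) : G) = _ from (congrArg Subtype.val hk).symm] at this)
  rw [hk] at hout
  exact (Subgroup.mul_mem_cancel_right K hkK).mp hout
end

section
/- Let G be a group, let P, Q ≤ G be subgroups, and let K ≤ P be a finite index subgroup of P with Q ∩ P ⊆ K. If the product KQ is separable in G, then there exists a finite index subgroup M ≤_f G such that Q ⊆ M and M ∩ P ⊆ K. -/
open Pointwise

/-- If `K ≤_f P`, `Q ∩ P ⊆ K` and `KQ` is separable in `G`, then there is `M ≤_f G`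
with `Q ⊆ M` and `M ∩ P ⊆ K`. -/
theorem stmt_8 {G : Type*} [Group G] (P Q K : Subgroup G) (hKP : K ≤ P)
    (hfi : (K.subgroupOf P).FiniteIndex) (hQP : Q ⊓ P ≤ K)
    (hsep : SepSubset ((K : Set G) * (Q : Set G))) :
    ∃ M : Subgroup G, M.FiniteIndex ∧ Q ≤ M ∧ M ⊓ P ≤ K := by
  have sep : ∀ c : P ⧸ K.subgroupOf P, ∃ N : Subgroup G, N.Normal ∧ N.FiniteIndex ∧
      (((c.out : P) : G)⁻¹ ∈ (K : Set G) * (Q : Set G) * (N : Set G) →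
        ((c.out : P) : G)⁻¹ ∈ K) := by
    intro c
    by_cases h : ((c.out : P) : G)⁻¹ ∈ (K : Set G) * (Q : Set G)
    · refine ⟨⊤, inferInstance, inferInstance, fun _ => ?_⟩
      obtain ⟨k, hk, q, hq, hkq⟩ := h
      have hqP : q ∈ P := by
        have hq' : q = k⁻¹ * ((c.out : P) : G)⁻¹ := by rw [← hkq]; simp
        rw [hq']
        exact P.mul_mem (P.inv_mem (hKP hk)) (P.inv_mem c.out.2)
      rw [← hkq]
      exact K.mul_mem hk (hQP ⟨hq, hqP⟩)
    · obtain ⟨N, hN, hNf, hcN⟩ := hsep _ h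
      exact ⟨N, hN, hNf, fun h' => absurd h' hcN⟩
  choose N hN hNf hNK using sep
  have : Finite (P ⧸ K.subgroupOf P) := Subgroup.finite_quotient_of_finiteIndex
  have hfin : (⨅ c, N c).FiniteIndex := Subgroup.finiteIndex_iInf hNf
  have hnorm : (⨅ c, N c).Normal := Subgroup.normal_iInf_normal hN
  refine ⟨Q ⊔ ⨅ c, N c, Subgroup.finiteIndex_of_le le_sup_right, le_sup_left, ?_⟩
  rintro x ⟨hxM, hxP⟩
  obtain ⟨q, hq, n, hn, rfl⟩ := Subgroup.mem_sup_of_normal_right.mp hxM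
  let c : P ⧸ K.subgroupOf P := QuotientGroup.mk (⟨q * n, hxP⟩ : P)⁻¹
  have hc : ((c.out : P) : G)⁻¹ * (q * n)⁻¹ ∈ K := by
    have h : (c.out)⁻¹ * (⟨q * n, hxP⟩ : P)⁻¹ ∈ K.subgroupOf P :=
      QuotientGroup.eq.mp (QuotientGroup.out_eq' c)
    exact Subgroup.mem_subgroupOf.mp h
  have hcK : ((c.out : P) : G)⁻¹ ∈ K := by
    refine hNK c ⟨_, ⟨_, hc, q, hq, rfl⟩, n, Subgroup.mem_iInf.mp hn c, ?_⟩
    group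
  simpa using K.mul_mem (K.inv_mem hc) hcK
end

section
/- Let A = B *_D C be an amalgamated free product, where B and C are subgroups of A with B ∩ C = D. If D is separable in A, then B, C and the product BC are all separable in A. -/
open Pointwise

universe u

/-- A group `A` with subgroups `B`, `C` is the amalgamated free product `B *_{B ⊓ C} C`:
`A` is generated by `B` and `C`, and `A` (with the inclusions of `B` and `C`) satisfies the
universal property of the pushout of `B ↩ B ⊓ C ↪ C`; equivalently, the canonical
homomorphism from that pushout to `A` is an isomorphism. -/
def IsAmalgam {A : Type u} [Group A] (B C : Subgroup A) : Prop :=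
  B ⊔ C = ⊤ ∧
  ∀ (H : Type u) [Group H] (f : B →* H) (g : C →* H),
    (∀ (x : A) (hxB : x ∈ B) (hxC : x ∈ C), f ⟨x, hxB⟩ = g ⟨x, hxC⟩) →
    ∃! h : A →* H, h.comp B.subtype = f ∧ h.comp C.subtype = g

open MulAction

section TruncatedWords

variable {T : Type*}

/-- Words over `T` of length at most `L` without two equal adjacent letters. -/
def TruncWord (T : Type*) (L : ℕ) : Type _ :=
  {l : List T // l.IsChain (· ≠ ·) ∧ l.length ≤ L}

instance [Finite T] (L : ℕ) : Finite (TruncWord T L) :=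
  ((List.finite_length_le T L).subset fun _ h => h.2).to_subtype

open Classical in
/-- Cancel the first letter if it is `x`; otherwise prepend `x` if there is room left. -/
noncomputable def toggle (L : ℕ) (x : T) (l : List T) : List T :=
  if l.head? = some x then l.tail else if l.length < L then x :: l else l

theorem toggle_of_head?_ne {L : ℕ} {x : T} {l : List T} (hx : l.head? ≠ some x)
    (hl : l.length < L) : toggle L x l = x :: l := by
  simp [toggle, hx, hl]

theorem toggle_cons_self (L : ℕ) (x : T) (l : List T) : toggle L x (x :: l) = l := by
  simp [toggle]

theorem toggle_mem {L : ℕ} (x : T) {l : List T}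
    (h : l.IsChain (· ≠ ·) ∧ l.length ≤ L) :
    (toggle L x l).IsChain (· ≠ ·) ∧ (toggle L x l).length ≤ L := by
  unfold toggle
  split_ifs with h₁ h₂
  · exact ⟨h.1.tail, by simp; omega⟩
  · refine ⟨List.isChain_cons.2 ⟨fun y hy hxy => h₁ (hxy ▸ hy), h.1⟩, by simpa using h₂⟩
  · exact h

theorem toggle_toggle {L : ℕ} (x : T) {l : List T}
    (h : l.IsChain (· ≠ ·) ∧ l.length ≤ L) : toggle L x (toggle L x l) = l := by
  by_cases h₁ : l.head? = some x
  · obtain ⟨l', rfl⟩ := List.head?_eq_some_iff.1 h₁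
    rw [toggle_cons_self]
    exact toggle_of_head?_ne (fun h' => (List.isChain_cons.1 h.1).1 x h' rfl)
      (by simpa using h.2)
  · by_cases h₂ : l.length < L
    · rw [toggle_of_head?_ne h₁ h₂, toggle_cons_self]
    · simp [toggle, h₁, h₂]

end TruncatedWords

section Twist

variable {Q : Type*} (D : Type*) [Group D] [MulAction D Q] (L : ℕ)

/-- The involution of `Q × TruncWord (Set Q) L` that toggles, in the fibre over `q`, the letter
given by the `D`-orbit of `q`. -/
noncomputable def twist : Equiv.Perm (Q × TruncWord (Set Q) L) :=
  Function.Involutive.toPerm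
    (fun x => (x.1, ⟨toggle L (orbit D x.1) x.2.1, toggle_mem _ x.2.2⟩))
    (fun x => Prod.ext rfl (Subtype.ext (toggle_toggle _ x.2.2)))

theorem twist_apply_fst (x : Q × TruncWord (Set Q) L) : (twist D L x).1 = x.1 := rfl

theorem twist_apply_snd (x : Q × TruncWord (Set Q) L) :
    (twist D L x).2.1 = toggle L (orbit D x.1) x.2.1 := rfl

theorem twist_inv : (twist (Q := Q) D L)⁻¹ = twist D L := rfl

end Twist

section Separability

variable {A : Type u} [Group A]

/-- The action of `A` on `(A ⧸ N) × F` through the first factor. -/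
def translation (N : Subgroup A) (F : Type*) : A →* Equiv.Perm ((A ⧸ N) × F) where
  toFun a := (MulAction.toPerm a).prodCongr (Equiv.refl F)
  map_one' := by ext x <;> simp
  map_mul' a b := by ext x <;> simp [mul_smul]

@[simp]
theorem translation_apply (N : Subgroup A) (F : Type*) (a : A) (x : (A ⧸ N) × F) :
    translation N F a x = (a • x.1, x.2) := rfl

theorem exists_normal_of_perm {X : Type*} [Finite X] (h : A →* Equiv.Perm X) (p : X)
    {Z : Set A} {g : A} (hg : ∀ z ∈ Z, h g p ≠ h z p) :
    ∃ N : Subgroup A, N.Normal ∧ N.FiniteIndex ∧ g ∉ Z * (N : Set A) := by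
  refine ⟨h.ker, inferInstance, inferInstance, ?_⟩
  rintro ⟨z, hz, k, hk, rfl⟩
  refine hg z hz ?_
  have hk : h k = 1 := hk
  simp [hk]

theorem SepSubset.exists_normal_forall_mem {Z : Set A} (hZ : SepSubset Z) (S : List A) :
    ∃ N : Subgroup A, N.Normal ∧ N.FiniteIndex ∧ ∀ x ∈ S, x ∉ Z → x ∉ Z * (N : Set A) := by
  induction S with
  | nil => exact ⟨⊤, inferInstance, inferInstance, by simp⟩
  | cons x S ih =>
    obtain ⟨N, hN, hNf, hNS⟩ := ih
    by_cases hx : x ∈ Z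
    · exact ⟨N, hN, hNf, by simpa [hx] using hNS⟩
    · obtain ⟨M, hM, hMf, hxM⟩ := hZ x hx
      refine ⟨N ⊓ M, inferInstance, inferInstance, ?_⟩
      intro y hy hyZ hyN
      rcases List.mem_cons.1 hy with rfl | hy
      · exact hxM (Set.mul_subset_mul_left (fun _ h => h.2) hyN)
      · exact hNS y hy hyZ (Set.mul_subset_mul_left (fun _ h => h.1) hyN)

theorem orbit_smul_ne {D N : Subgroup A} [N.Normal] {a : A}
    (ha : a ∉ (D : Set A) * (N : Set A)) (q : A ⧸ N) : orbit D (a • q) ≠ orbit D q := by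
  induction q using QuotientGroup.induction_on with
  | H x =>
    intro h
    obtain ⟨d, hd⟩ := orbit_eq_iff.1 h
    have hd : ((d * x : A) : A ⧸ N) = ((a * x : A) : A ⧸ N) := hd
    rw [QuotientGroup.mk_mul, QuotientGroup.mk_mul, mul_left_inj, QuotientGroup.eq] at hd
    exact ha ⟨d, d.2, _, hd, by simp⟩

/-- The product `c₁ b₁ c₂ b₂ ⋯` of a list of pairs `(cᵢ, bᵢ)`. -/
def pairProd : List (A × A) → A
  | [] => 1
  | p :: l => p.1 * p.2 * pairProd l

/-- Lists of pairs `(c, b)` with `c ∈ C ∖ B` and `b ∈ B`, where every `b` but the last one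
lies outside `C`. -/
def IsReducedPairs (B C : Subgroup A) : List (A × A) → Prop
  | [] => True
  | p :: l => (p.1 ∈ C ∧ p.1 ∉ B ∧ p.2 ∈ B ∧ (p.2 ∉ C ∨ l = [])) ∧ IsReducedPairs B C l

theorem exists_reducedPairs_mul_left {B C : Subgroup A} {c b : A} {l : List (A × A)}
    (hc : c ∈ C) (hb : b ∈ B) (hl : IsReducedPairs B C l) :
    ∃ b' ∈ B, ∃ l', IsReducedPairs B C l' ∧ c * (b * pairProd l) = b' * pairProd l' := by
  by_cases hcB : c ∈ B
  · exact ⟨c * b, mul_mem hcB hb, l, hl, by group⟩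
  by_cases hbC : b ∈ C
  · cases l with
    | nil => exact ⟨1, one_mem _, [(c, b)], ⟨⟨hc, hcB, hb, .inr rfl⟩, trivial⟩, by simp [pairProd]⟩
    | cons p l =>
      obtain ⟨⟨h₁, h₂, h₃, h₄⟩, hl⟩ := hl
      by_cases h : c * b * p.1 ∈ B
      · exact ⟨c * b * p.1 * p.2, mul_mem h h₃, l, hl, by simp [pairProd, mul_assoc]⟩
      · exact ⟨1, one_mem _, (c * b * p.1, p.2) :: l,
          ⟨⟨mul_mem (mul_mem hc hbC) h₁, h, h₃, h₄⟩, hl⟩, by simp [pairProd, mul_assoc]⟩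
  · exact ⟨1, one_mem _, (c, b) :: l, ⟨⟨hc, hcB, hb, .inl hbC⟩, hl⟩,
      by simp [pairProd, mul_assoc]⟩

theorem exists_reducedPairs {B C : Subgroup A} (h : B ⊔ C = ⊤) (a : A) :
    ∃ b ∈ B, ∃ l, IsReducedPairs B C l ∧ a = b * pairProd l := by
  have key : ∀ x ∈ (B : Set A) ∪ C, ∀ y,
      (∃ b ∈ B, ∃ l, IsReducedPairs B C l ∧ y = b * pairProd l) →
      ∃ b ∈ B, ∃ l, IsReducedPairs B C l ∧ x * y = b * pairProd l := by
    rintro x (hx | hx) _ ⟨b, hb, l, hl, rfl⟩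
    · exact ⟨x * b, mul_mem hx hb, l, hl, by group⟩
    · exact exists_reducedPairs_mul_left hx hb hl
  have ha : a ∈ Subgroup.closure ((B : Set A) ∪ C) := by
    rw [← Subgroup.sup_eq_closure, h]; trivial
  induction ha using Subgroup.closure_induction_left with
  | one => exact ⟨1, one_mem _, [], trivial, by simp [pairProd]⟩
  | mul_left x hx y _ ih => exact key x hx y ih
  | inv_mul_cancel x hx y _ ih =>
    exact key x⁻¹ (hx.imp (fun h => B.inv_mem h) fun h => C.inv_mem h) y ih

theorem IsAmalgam.symm {B C : Subgroup A} (h : IsAmalgam B C) : IsAmalgam C B := by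
  refine ⟨sup_comm B C ▸ h.1, fun H _ f g hfg => ?_⟩
  obtain ⟨k, hk, hu⟩ := h.2 H g f fun x hB hC => (hfg x hC hB).symm
  exact ⟨k, hk.symm, fun k' hk' => hu k' hk'.symm⟩

/-- In an amalgam, `B` can act by translations and `C` by translations conjugated with `twist`. -/
theorem IsAmalgam.exists_twisted_hom {B C : Subgroup A} (h : IsAmalgam B C)
    (N : Subgroup A) (L : ℕ) :
    ∃ φ : A →* Equiv.Perm ((A ⧸ N) × TruncWord (Set (A ⧸ N)) L),
      (∀ b ∈ B, φ b = translation N _ b) ∧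
      ∀ c ∈ C, φ c = twist (B ⊓ C : Subgroup A) L * translation N _ c *
        twist (B ⊓ C : Subgroup A) L := by
  set τ : Equiv.Perm ((A ⧸ N) × TruncWord (Set (A ⧸ N)) L) := twist (B ⊓ C : Subgroup A) L with hτ
  have hinv : τ⁻¹ = τ := twist_inv _ _
  have hcomm : ∀ d ∈ B ⊓ C, τ * translation N _ d = translation N _ d * τ := by
    intro d hd
    ext1 x
    refine Prod.ext rfl (Subtype.ext ?_)
    have : orbit (B ⊓ C : Subgroup A) (d • x.1) = orbit (B ⊓ C : Subgroup A) x.1 :=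
      orbit_eq_iff.2 ⟨⟨d, hd⟩, rfl⟩
    simp [hτ, twist_apply_snd, this]
  obtain ⟨φ, ⟨hB, hC⟩, -⟩ := h.2 _ ((translation N _).comp B.subtype)
    (((MulAut.conj τ).toMonoidHom.comp (translation N _)).comp C.subtype) (by
      intro x hxB hxC
      simp [hcomm x ⟨hxB, hxC⟩])
  refine ⟨φ, fun b hb => DFunLike.congr_fun hB ⟨b, hb⟩, fun c hc => ?_⟩
  have := DFunLike.congr_fun hC ⟨c, hc⟩
  simpa [hinv] using this

/-- The trajectory of a reduced word is recorded, without cancellation, in the word component. -/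
theorem twisted_hom_pairProd {B C N : Subgroup A} [N.Normal] {L : ℕ}
    {φ : A →* Equiv.Perm ((A ⧸ N) × TruncWord (Set (A ⧸ N)) L)}
    (hB : ∀ b ∈ B, φ b = translation N _ b)
    (hC : ∀ c ∈ C, φ c = twist (B ⊓ C : Subgroup A) L * translation N _ c *
      twist (B ⊓ C : Subgroup A) L)
    {p : (A ⧸ N) × TruncWord (Set (A ⧸ N)) L} (hp : p.2.1 = [])
    {l : List (A × A)} (hl : IsReducedPairs B C l) (hL : 2 * l.length ≤ L)
    (hN : ∀ x ∈ l, ∀ y ∈ [x.1, x.2], y ∉ B ⊓ C →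
      y ∉ ((B ⊓ C : Subgroup A) : Set A) * (N : Set A)) :
    (φ (pairProd l) p).1 = pairProd l • p.1 ∧
    (φ (pairProd l) p).2.1.length = 2 * l.length ∧
    (∀ x ∈ (φ (pairProd l) p).2.1.head?,
      x = orbit (B ⊓ C : Subgroup A) (pairProd l • p.1)) ∧
    ∀ x, l = [x] → (φ (pairProd l) p).2.1 =
      [orbit (B ⊓ C : Subgroup A) ((x.1 * x.2) • p.1),
        orbit (B ⊓ C : Subgroup A) (x.2 • p.1)] := by
  induction l with
  | nil => simp [pairProd, hp]
  | cons x l ih =>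
    obtain ⟨⟨hxC, hxB, hx₂, hx₂'⟩, hl⟩ := hl
    simp only [List.length_cons] at hL
    obtain ⟨ih₁, ih₂, ih₃, -⟩ := ih hl (by omega) fun y hy => hN y (List.mem_cons_of_mem _ hy)
    set r := φ (pairProd l) p with hr
    have hφ : φ (pairProd (x :: l)) p = φ x.1 (φ x.2 r) := by simp [pairProd, hr]
    have hne : r.2.1.head? ≠ some (orbit (B ⊓ C : Subgroup A) (x.2 • r.1)) := by
      intro h
      rcases hx₂' with hx₂' | rfl
      · have := ih₃ _ h
        rw [← ih₁] at this
        exact orbit_smul_ne (hN x (by simp) x.2 (by simp) fun h => hx₂' h.2) _ this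
      · have h0 : r.2.1 = [] := List.length_eq_zero_iff.1 (by simpa using ih₂)
        simp [h0] at h
    have hne' : orbit (B ⊓ C : Subgroup A) (x.1 • x.2 • r.1) ≠
        orbit (B ⊓ C : Subgroup A) (x.2 • r.1) :=
      orbit_smul_ne (hN x (by simp) x.1 (by simp) fun h => hxB h.1) _
    have hfst : (φ x.1 (φ x.2 r)).1 = x.1 • x.2 • r.1 := by
      simp [hC _ hxC, hB _ hx₂, twist_apply_fst]
    have hsnd : (φ x.1 (φ x.2 r)).2.1 =
        orbit (B ⊓ C : Subgroup A) (x.1 • x.2 • r.1) ::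
          orbit (B ⊓ C : Subgroup A) (x.2 • r.1) :: r.2.1 := by
      simp only [hC _ hxC, hB _ hx₂, Equiv.Perm.mul_apply, translation_apply, twist_apply_snd,
        twist_apply_fst]
      rw [toggle_of_head?_ne hne (by omega), toggle_of_head?_ne]
      · simpa using hne'.symm
      · simp only [List.length_cons]; omega
    rw [hφ, hfst, hsnd, ih₁]
    refine ⟨by simp [pairProd, mul_smul], by simp [ih₂]; ring, by simp [pairProd, mul_smul], ?_⟩
    rintro y hy
    obtain ⟨rfl, rfl⟩ := List.cons_eq_cons.1 hy
    have h0 : r.2.1 = [] := List.length_eq_zero_iff.1 (by simpa using ih₂)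
    simp [h0, pairProd, mul_smul]

theorem IsAmalgam.exists_separating_hom {B C : Subgroup A} (hAm : IsAmalgam B C)
    (hD : SepSubset (((B ⊓ C : Subgroup A) : Set A))) (g : A) :
    ∃ (X : Type u) (_ : Finite X) (φ : A →* Equiv.Perm X) (p : X),
      (g ∉ B → ∀ z ∈ B, φ g p ≠ φ z p) ∧
      (g ∉ (B : Set A) * (C : Set A) → ∀ z ∈ (B : Set A) * (C : Set A), φ g p ≠ φ z p) := by
  obtain ⟨b, hb, l, hl, rfl⟩ := exists_reducedPairs hAm.1 g
  obtain ⟨N, hNn, hNf, hN⟩ := hD.exists_normal_forall_mem (l.flatMap fun x => [x.1, x.2])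
  have hN' : ∀ x ∈ l, ∀ y ∈ [x.1, x.2], y ∉ B ⊓ C →
      y ∉ ((B ⊓ C : Subgroup A) : Set A) * (N : Set A) :=
    fun x hx y hy => hN y (List.mem_flatMap.2 ⟨x, hx, hy⟩)
  set L := 2 * l.length + 2 with hLdef
  obtain ⟨φ, hB, hC⟩ := hAm.exists_twisted_hom N L
  let p : (A ⧸ N) × TruncWord (Set (A ⧸ N)) L := ((1 : A), ⟨[], by simp⟩)
  obtain ⟨-, h₂, -, h₄⟩ := twisted_hom_pairProd (p := p) hB hC rfl hl (by omega) hN'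
  have hword : ∀ b ∈ B, ∀ x, (φ (b * x) p).2 = (φ x p).2 := by
    intro b hb x
    simp [hB b hb]
  refine ⟨_, inferInstance, φ, p, fun hg z hz h => ?_, ?_⟩
  · have h := congrArg (fun r => r.2.1.length) h
    have hz' : (φ z p).2.1 = [] := by rw [hB z hz]; rfl
    simp only [hword b hb, h₂, hz'] at h
    obtain rfl : l = [] := List.length_eq_zero_iff.1 (by simpa using h)
    exact hg (by simpa [pairProd] using hb)
  · rintro hg _ ⟨b', hb', c, hc, rfl⟩ h
    have h := congrArg (fun r => r.2.1) h
    simp only [hword b hb, hword b' hb'] at h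
    have hcp : (φ c p).2.1 = toggle L (orbit (B ⊓ C : Subgroup A) (c • p.1))
        [orbit (B ⊓ C : Subgroup A) p.1] := by
      simp only [hC _ hc, Equiv.Perm.mul_apply, translation_apply, twist_apply_snd,
        twist_apply_fst]
      rw [toggle_of_head?_ne (l := p.2.1) (by simp [p]) (by simp [p, hLdef])]
    rw [hcp] at h
    match l, hl with
    | [], _ =>
      exact hg ⟨b, hb, 1, one_mem _, by simp [pairProd]⟩
    | [x], hl =>
      obtain ⟨⟨hxC, -, hx₂, -⟩, -⟩ := hl
      have hx : x.2 ∉ C := fun hx => hg ⟨b, hb, x.1 * x.2, mul_mem hxC hx, by simp [pairProd]⟩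
      have hne := orbit_smul_ne (hN' x (by simp) x.2 (by simp) fun h => hx h.2) p.1
      rw [h₄ x rfl] at h
      unfold toggle at h
      split_ifs at h
      all_goals simp_all
    | x :: y :: l, _ =>
      have h := congrArg List.length h
      rw [h₂] at h
      unfold toggle at h
      split_ifs at h
      all_goals simp at h

theorem IsAmalgam.sepSubset_left {B C : Subgroup A} (hAm : IsAmalgam B C)
    (hD : SepSubset (((B ⊓ C : Subgroup A) : Set A))) : SepSubset (B : Set A) := by
  intro g hg
  obtain ⟨X, _, φ, p, h, -⟩ := hAm.exists_separating_hom hD g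
  exact exists_normal_of_perm φ p (h hg)

end Separability

/-- In an amalgamated free product `A = B *_D C` with `D = B ∩ C` separable in `A`,
the subgroups `B`, `C` and the product `BC` are all separable in `A`. -/
theorem stmt_10 {A : Type u} [Group A] (B C : Subgroup A) (hAm : IsAmalgam B C)
    (hD : SepSubset (((B ⊓ C : Subgroup A) : Set A))) :
    SepSubset (B : Set A) ∧ SepSubset (C : Set A) ∧
      SepSubset ((B : Set A) * (C : Set A)) := by
  refine ⟨hAm.sepSubset_left hD, hAm.symm.sepSubset_left (inf_comm B C ▸ hD), fun g hg => ?_⟩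
  obtain ⟨X, _, φ, p, -, h⟩ := hAm.exists_separating_hom hD g
  exact exists_normal_of_perm φ p (h hg)
end

section
/- Let A = B *_D C be an amalgamated free product, where B and C are subgroups of A with B ∩ C = D. Suppose U ⊆ B and V ⊆ C are subsets such that the products UD and DV are separable in A. Then the triple product UDV is separable in A. -/
open Pointwise

universe u

/-- A partial bijection of a finite type extends to a permutation. -/
theorem exists_perm_of_rel {X : Type*} [Finite X] (R : X → X → Prop)
    (hfun : ∀ x y y', R x y → R x y' → y = y') (hinj : ∀ x x' y, R x y → R x' y → x = x') :
    ∃ σ : Equiv.Perm X, ∀ x y, R x y → σ x = y := by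
  classical
  have := Fintype.ofFinite X
  choose f hf using fun x : {x // ∃ y, R x y} => x.2
  choose k hk using fun y : {y // ∃ x, R x y} => y.2
  let e : {x // ∃ y, R x y} ≃ {y // ∃ x, R x y} :=
    { toFun := fun x => ⟨f x, x, hf x⟩
      invFun := fun y => ⟨k y, y, hk y⟩
      left_inv := fun x => Subtype.ext (hinj _ _ _ (hk ⟨f x, x, hf x⟩) (hf x))
      right_inv := fun y => Subtype.ext (hfun _ _ _ (hf ⟨k y, y, hk y⟩) (hk y)) }
  refine ⟨e.extendSubtype, fun x y h => ?_⟩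
  rw [Equiv.extendSubtype_apply_of_mem e x ⟨y, h⟩]
  exact hfun _ _ _ (hf ⟨x, y, h⟩) h

/-- A reduced word of length `n` can be made to act on `Fin (n + 1)` so that it moves the last
point to the first one. -/
theorem FreeGroup.IsReduced.exists_lift_last {α : Type*} {L : List (α × Bool)}
    (hL : FreeGroup.IsReduced L) :
    ∃ τ : α → Equiv.Perm (Fin (L.length + 1)),
      FreeGroup.lift τ (FreeGroup.mk L) (Fin.last L.length) = 0 := by
  have hR : ∀ a : α, ∃ σ : Equiv.Perm (Fin (L.length + 1)), ∀ x y : Fin (L.length + 1),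
      ((x.val = y.val + 1 ∧ L[y.val]? = some (a, true)) ∨
        (y.val = x.val + 1 ∧ L[x.val]? = some (a, false))) → σ x = y := by
    have key : ∀ (a : α) (i : ℕ) (b b' : Bool),
        L[i]? = some (a, b) → L[i + 1]? = some (a, b') → b = b' := by
      intro a i b b' h h'
      obtain ⟨hi, h⟩ := List.getElem?_eq_some_iff.1 h
      obtain ⟨hi', h'⟩ := List.getElem?_eq_some_iff.1 h'
      have := List.isChain_iff_getElem.1 hL i hi'
      rw [h, h'] at this
      exact this rfl
    intro a
    refine exists_perm_of_rel _ ?_ ?_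
    · rintro x y y' (⟨h, h1⟩ | ⟨h, h1⟩) (⟨h', h1'⟩ | ⟨h', h1'⟩)
      · exact Fin.ext (by omega)
      · rw [h] at h1'
        cases key a _ _ _ h1 h1'
      · rw [h'] at h1
        cases key a _ _ _ h1' h1
      · exact Fin.ext (by omega)
    · rintro x x' y (⟨h, h1⟩ | ⟨h, h1⟩) (⟨h', h1'⟩ | ⟨h', h1'⟩)
      · exact Fin.ext (by omega)
      · rw [h'] at h1
        cases key a _ _ _ h1' h1
      · rw [h] at h1'
        cases key a _ _ _ h1 h1'
      · exact Fin.ext (by omega)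
  choose τ hτ using hR
  refine ⟨τ, ?_⟩
  have main : ∀ L₂ L₁ : List (α × Bool), L = L₁ ++ L₂ →
      (FreeGroup.lift τ (FreeGroup.mk L₂) (Fin.last L.length)).val = L₁.length := by
    intro L₂
    induction L₂ with
    | nil =>
      rintro L₁ rfl
      rw [← FreeGroup.one_eq_mk, _root_.map_one]
      simp
    | cons p L₂ ih =>
      intro L₁ h
      have ih := ih (L₁ ++ [p]) (by simp [h])
      obtain ⟨a, b⟩ := p
      have hget : L[L₁.length]? = some (a, b) := by simp [h]
      have hlt : L₁.length < L.length + 1 := by simp [h]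
      rw [show (a, b) :: L₂ = [(a, b)] ++ L₂ from rfl, ← FreeGroup.mul_mk, _root_.map_mul,
        Equiv.Perm.mul_apply]
      set x := FreeGroup.lift τ (FreeGroup.mk L₂) (Fin.last L.length)
      rw [List.length_append, List.length_singleton] at ih
      cases b with
      | true =>
        have h1 := hτ a x ⟨L₁.length, hlt⟩ (Or.inl ⟨ih, hget⟩)
        simp [FreeGroup.lift_mk, h1]
      | false =>
        have h1 := hτ a ⟨L₁.length, hlt⟩ x (Or.inr ⟨ih, hget⟩)
        simp [FreeGroup.lift_mk, ← h1]
  exact Fin.ext (main L [] rfl)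

/-- Free groups are residually finite. -/
theorem FreeGroup.exists_finiteIndex_notMem {α : Type*} {w : FreeGroup α} (hw : w ≠ 1) :
    ∃ M : Subgroup (FreeGroup α), M.Normal ∧ M.FiniteIndex ∧ w ∉ M := by
  classical
  obtain ⟨τ, hτ⟩ := (FreeGroup.isReduced_toWord (x := w)).exists_lift_last
  refine ⟨(FreeGroup.lift τ).ker, inferInstance, inferInstance, fun h => hw ?_⟩
  rw [FreeGroup.mk_toWord, MonoidHom.mem_ker.1 h] at hτ
  rw [← FreeGroup.toWord_eq_nil_iff, ← List.length_eq_zero_iff]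
  simpa using congrArg Fin.val hτ

theorem FreeGroup.of_mul_of_inv {α : Type*} (a b : α) :
    FreeGroup.of a * (FreeGroup.of b)⁻¹ = FreeGroup.mk [(a, true), (b, false)] :=
  rfl

/-- Finitely many finite index normal subgroups have a common one below them. -/
theorem exists_finiteIndex_forall_mem {G ι : Type*} [Group G] {S : Set ι} (hS : S.Finite)
    (P : ι → Subgroup G → Prop) (hmono : ∀ i N N', N ≤ N' → P i N' → P i N)
    (hP : ∀ i ∈ S, ∃ N : Subgroup G, N.Normal ∧ N.FiniteIndex ∧ P i N) :
    ∃ N : Subgroup G, N.Normal ∧ N.FiniteIndex ∧ ∀ i ∈ S, P i N := by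
  induction S, hS using Set.Finite.induction_on with
  | empty => exact ⟨⊤, inferInstance, inferInstance, by simp⟩
  | insert _ _ ih =>
    obtain ⟨N, hN, hN', h⟩ := ih fun i hi => hP i (Set.mem_insert_of_mem _ hi)
    obtain ⟨N₁, hN₁, hN₁', h₁⟩ := hP _ (Set.mem_insert _ _)
    refine ⟨N ⊓ N₁, inferInstance, inferInstance, ?_⟩
    rintro i (rfl | hi)
    · exact hmono _ _ _ inf_le_right h₁
    · exact hmono _ _ _ inf_le_left (h i hi)

/-- The product `b₁ c₁ b₂ c₂ ⋯` of a list of pairs. -/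
def altProd {A : Type*} [Group A] : List (A × A) → A
  | [] => 1
  | p :: l => p.1 * p.2 * altProd l

/-- The word recording, in the labels `e`, the endpoints of the moves made by the first components
of the pairs when `altProd l` acts on `1` one factor at a time. -/
def altWord {A E : Type*} [Group A] (e : A → E) : List (A × A) → List (E × Bool)
  | [] => []
  | p :: l => (e (p.1 * (p.2 * altProd l)), true) :: (e (p.2 * altProd l), false) :: altWord e l

theorem altWord_length {A E : Type*} [Group A] (e : A → E) (l : List (A × A)) :
    (altWord e l).length = 2 * l.length := by
  induction l with
  | nil => rfl
  | cons p l ih => simp [altWord, ih]; ring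

theorem altWord_isReduced {A E : Type*} [Group A] (e : A → E) (P : A → Prop)
    (he : ∀ a x, e (a * x) = e x → P a) (l : List (A × A)) (h1 : ∀ p ∈ l, ¬ P p.1)
    (h2 : l.IsChain fun p _ => ¬ P p.2) : FreeGroup.IsReduced (altWord e l) := by
  induction l with
  | nil => exact FreeGroup.IsReduced.nil
  | cons p l ih =>
    have ih := ih (fun q hq => h1 q (List.mem_cons_of_mem _ hq)) h2.tail
    have hp : e (p.1 * (p.2 * altProd l)) ≠ e (p.2 * altProd l) :=
      fun h => h1 p List.mem_cons_self (he _ _ h)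
    cases l with
    | nil => simp [altWord, hp]
    | cons q l =>
      have hq : e (p.2 * altProd (q :: l)) ≠ e (q.1 * (q.2 * altProd l)) := by
        intro h
        rw [← mul_assoc q.1] at h
        exact (List.isChain_cons_cons.1 h2).1 (he _ _ h)
      simp only [altWord, FreeGroup.isReduced_cons_cons] at ih ⊢
      exact ⟨fun h => absurd h hp, fun h => absurd h hq, ih⟩

/-- `a` is an alternating product `c b₁ c₁ ⋯ bₙ cₙ` in which no `bᵢ`, and no `cᵢ` with
`1 ≤ i < n`, lies in `B ⊓ C`. -/
def HasAltForm {A : Type*} [Group A] (B C : Subgroup A) (a : A) : Prop :=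
  ∃ c ∈ C, ∃ l : List (A × A), (∀ p ∈ l, p.1 ∈ B ∧ p.2 ∈ C) ∧ (∀ p ∈ l, p.1 ∉ B ⊓ C) ∧
    l.IsChain (fun p _ => p.2 ∉ B ⊓ C) ∧ a = c * altProd l

theorem HasAltForm.mul_left {A : Type*} [Group A] {B C : Subgroup A} {x a : A}
    (hx : x ∈ B ∨ x ∈ C) (ha : HasAltForm B C a) : HasAltForm B C (x * a) := by
  obtain ⟨c, hc, l, hl, h1, h2, rfl⟩ := ha
  by_cases hxC : x ∈ C
  · exact ⟨x * c, C.mul_mem hxC hc, l, hl, h1, h2, by group⟩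
  have hxB : x ∈ B := hx.resolve_right hxC
  by_cases hcl : c ∈ B ∧ l ≠ []
  · obtain ⟨hcB, hne⟩ := hcl
    obtain ⟨⟨b, d⟩, l, rfl⟩ := List.exists_cons_of_ne_nil hne
    simp only [List.forall_mem_cons] at hl h1
    have hyB : x * c * b ∈ B := B.mul_mem (B.mul_mem hxB hcB) hl.1.1
    by_cases hyC : x * c * b ∈ C
    · refine ⟨x * c * b * d, C.mul_mem hyC hl.1.2, l, hl.2, h1.2, h2.tail, ?_⟩
      simp [altProd, mul_assoc]
    · refine ⟨1, C.one_mem, (x * c * b, d) :: l, ?_, ?_, ?_, ?_⟩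
      · simp only [List.forall_mem_cons]
        exact ⟨⟨hyB, hl.1.2⟩, hl.2⟩
      · simp only [List.forall_mem_cons]
        exact ⟨fun h => hyC h.2, h1.2⟩
      · rw [List.isChain_cons] at h2 ⊢
        exact h2
      · simp [altProd, mul_assoc]
  · refine ⟨1, C.one_mem, (x, c) :: l, ?_, ?_, ?_, ?_⟩
    · simp only [List.forall_mem_cons]
      exact ⟨⟨hxB, hc⟩, hl⟩
    · simp only [List.forall_mem_cons]
      exact ⟨fun h => hxC h.2, h1⟩
    · refine List.isChain_cons.2 ⟨fun q hq h => hcl ⟨h.1, ?_⟩, h2⟩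
      rintro rfl
      simp at hq
    · simp [altProd, mul_assoc]

theorem hasAltForm_of_sup_eq_top {A : Type*} [Group A] {B C : Subgroup A} (hBC : B ⊔ C = ⊤)
    (a : A) : HasAltForm B C a := by
  have ha : a ∈ Subgroup.closure ((B : Set A) ∪ C) := by
    rw [← Subgroup.sup_eq_closure, hBC]
    trivial
  induction ha using Subgroup.closure_induction_left with
  | one => exact ⟨1, C.one_mem, [], by simp, by simp, by simp, by simp [altProd]⟩
  | mul_left x hx y _ ih => exact ih.mul_left hx
  | inv_mul_cancel x hx y _ ih => exact ih.mul_left (hx.imp B.inv_mem C.inv_mem)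

/-- Twisting the translation action of `B` on `A ⧸ N` by a function `t` that is constant on the
orbits of `B ⊓ C` yields an action of the amalgam on `(A ⧸ N) × F`. -/
theorem IsAmalgam.exists_twisted_action {A F : Type u} [Group A] [Group F] {B C : Subgroup A}
    (hAm : IsAmalgam B C) (N : Subgroup A) (t : A ⧸ N → F)
    (ht : ∀ d ∈ B ⊓ C, ∀ q, t (d • q) = t q) :
    ∃ h : A →* Equiv.Perm ((A ⧸ N) × F), (∀ c ∈ C, ∀ q y, h c (q, y) = (c • q, y)) ∧
      ∀ b ∈ B, ∀ q y, h b (q, y) = (b • q, t (b • q) * (t q)⁻¹ * y) := by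
  let ψ : A →* Equiv.Perm ((A ⧸ N) × F) :=
    { toFun := fun a => (MulAction.toPerm a).prodCongr (Equiv.refl F)
      map_one' := by ext x <;> simp
      map_mul' := fun a b => by ext x <;> simp [mul_smul] }
  have hψ : ∀ a q y, ψ a (q, y) = (a • q, y) := fun a q y => rfl
  let θ : Equiv.Perm ((A ⧸ N) × F) := Equiv.prodShear (Equiv.refl _) fun q => Equiv.mulLeft (t q)
  have hθ : ∀ q y, θ (q, y) = (q, t q * y) := fun q y => rfl
  have hθ' : ∀ q y, θ⁻¹ (q, y) = (q, (t q)⁻¹ * y) := fun q y => by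
    rw [Equiv.Perm.inv_eq_iff_eq, hθ, mul_inv_cancel_left]
  have hB : ∀ b q y, (θ * ψ b * θ⁻¹) (q, y) = (b • q, t (b • q) * (t q)⁻¹ * y) := fun b q y => by
    rw [Equiv.Perm.mul_apply, Equiv.Perm.mul_apply, hθ', hψ, hθ, mul_assoc]
  obtain ⟨h, ⟨h1, h2⟩, -⟩ := hAm.2 (Equiv.Perm ((A ⧸ N) × F))
    (((MulAut.conj θ).toMonoidHom.comp ψ).comp B.subtype) (ψ.comp C.subtype) (by
      rintro x hxB hxC
      refine Equiv.ext fun ⟨q, y⟩ => ?_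
      change (θ * ψ x * θ⁻¹) (q, y) = ψ x (q, y)
      rw [hB, hψ, ht x ⟨hxB, hxC⟩, mul_inv_cancel, one_mul])
  refine ⟨h, fun c hc q y => ?_, fun b hb q y => ?_⟩
  · rw [← hψ]
    exact congrArg (fun k => k (q, y)) (DFunLike.congr_fun h2 ⟨c, hc⟩)
  · rw [← hB]
    exact congrArg (fun k => k (q, y)) (DFunLike.congr_fun h1 ⟨b, hb⟩)

/-- Membership in a product with a normal subgroup, tested in the quotient. -/
theorem mem_mul_iff_exists_mk_eq {A : Type*} [Group A] {N : Subgroup A} {Z : Set A} {a : A} :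
    a ∈ Z * (N : Set A) ↔ ∃ z ∈ Z, (z : A ⧸ N) = a := by
  simp only [Set.mem_mul, SetLike.mem_coe, QuotientGroup.eq]
  constructor
  · rintro ⟨z, hz, n, hn, rfl⟩
    exact ⟨z, hz, by simpa using hn⟩
  · rintro ⟨z, hz, h⟩
    exact ⟨z, hz, _, h, by simp⟩

/-- Label of the orbit under `B ⊓ C` of the image of `a` in `A ⧸ N`. -/
def orbitLabel {A : Type*} [Group A] (B C N : Subgroup A) (a : A) :
    MulAction.orbitRel.Quotient (B ⊓ C : Subgroup A) (A ⧸ N) :=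
  Quotient.mk'' (a : A ⧸ N)

theorem orbitLabel_eq_iff {A : Type*} [Group A] {B C N : Subgroup A} {a a' : A} :
    orbitLabel B C N a = orbitLabel B C N a' ↔ ∃ d ∈ B ⊓ C, ((d * a' : A) : A ⧸ N) = a := by
  unfold orbitLabel
  rw [Quotient.eq'', MulAction.orbitRel_apply, MulAction.mem_orbit_iff]
  constructor
  · rintro ⟨d, h⟩
    exact ⟨d, d.2, h⟩
  · rintro ⟨d, hd, h⟩
    exact ⟨⟨d, hd⟩, h⟩

theorem orbitLabel_mul_eq_imp {A : Type*} [Group A] {B C N : Subgroup A} [N.Normal] {a x : A}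
    (h : orbitLabel B C N (a * x) = orbitLabel B C N x) :
    a ∈ ((B ⊓ C : Subgroup A) : Set A) * (N : Set A) := by
  obtain ⟨d, hd, h⟩ := orbitLabel_eq_iff.1 h
  rw [mem_mul_iff_exists_mk_eq]
  refine ⟨d, hd, ?_⟩
  rw [QuotientGroup.mk_mul, QuotientGroup.mk_mul] at h
  exact mul_right_cancel h

/-- If the word of `g` in the free group on orbit labels differs from that of every `b * c` with
`b ∈ X`, `c ∈ Y` having the same image modulo `N`, then `g` can be separated from `X * Y`. -/
theorem IsAmalgam.exists_separating {A : Type u} [Group A] {B C : Subgroup A}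
    (hAm : IsAmalgam B C) {X Y : Set A} (hX : X ⊆ B) (hY : Y ⊆ C) (N : Subgroup A)
    [N.Normal] [N.FiniteIndex] {c₀ : A} (hc₀ : c₀ ∈ C) {l : List (A × A)}
    (hl : ∀ p ∈ l, p.1 ∈ B ∧ p.2 ∈ C)
    (hsep : ∀ b ∈ X, ∀ c ∈ Y, ((c₀ * altProd l : A) : A ⧸ N) = (b * c : A) →
      FreeGroup.mk (altWord (orbitLabel B C N) l) ≠
        FreeGroup.of (orbitLabel B C N (b * c)) * (FreeGroup.of (orbitLabel B C N c))⁻¹) :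
    ∃ K : Subgroup A, K.Normal ∧ K.FiniteIndex ∧ c₀ * altProd l ∉ X * Y * (K : Set A) := by
  let E := MulAction.orbitRel.Quotient (B ⊓ C : Subgroup A) (A ⧸ N)
  let e : A → E := orbitLabel B C N
  have : Finite E := Quotient.finite _
  obtain ⟨M, hM, hM', hMS⟩ := exists_finiteIndex_forall_mem (G := FreeGroup E)
    (Set.finite_univ (α := E × E))
    (fun i M => (FreeGroup.of i.1 * (FreeGroup.of i.2)⁻¹)⁻¹ * FreeGroup.mk (altWord e l) ∈ M →
      FreeGroup.mk (altWord e l) = FreeGroup.of i.1 * (FreeGroup.of i.2)⁻¹)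
    (fun i M M' hle h hi => h (hle hi)) (by
      intro i _
      by_cases hi : FreeGroup.mk (altWord e l) = FreeGroup.of i.1 * (FreeGroup.of i.2)⁻¹
      · exact ⟨⊤, inferInstance, inferInstance, fun _ => hi⟩
      · obtain ⟨M, h, h', hM⟩ := FreeGroup.exists_finiteIndex_notMem
          (w := (FreeGroup.of i.1 * (FreeGroup.of i.2)⁻¹)⁻¹ * FreeGroup.mk (altWord e l))
          (fun h => hi (inv_mul_eq_one.1 h).symm)
        exact ⟨M, h, h', fun h => absurd h hM⟩)
  let t : A ⧸ N → FreeGroup E ⧸ M := fun q => (FreeGroup.of (Quotient.mk'' q : E) : FreeGroup E)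
  obtain ⟨h, hC, hB⟩ := hAm.exists_twisted_action N t (by
    intro d hd q
    have : (Quotient.mk'' (d • q) : E) = Quotient.mk'' q :=
      Quotient.eq''.2 (MulAction.orbitRel_apply.2 ⟨⟨d, hd⟩, rfl⟩)
    simp only [t, this])
  have hB' : ∀ b ∈ B, ∀ (a : A) y, h b ((a : A ⧸ N), y) = (((b * a : A) : A ⧸ N),
      ((FreeGroup.of (e (b * a)) * (FreeGroup.of (e a))⁻¹ : FreeGroup E) : FreeGroup E ⧸ M) * y) :=
    fun b hb a y => hB b hb a y
  have hC' : ∀ c ∈ C, ∀ (a : A) y, h c ((a : A ⧸ N), y) = (((c * a : A) : A ⧸ N), y) :=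
    fun c hc a y => hC c hc a y
  have hword : h (altProd l) (((1 : A) : A ⧸ N), 1) =
      (((altProd l : A) : A ⧸ N),
        ((FreeGroup.mk (altWord e l) : FreeGroup E) : FreeGroup E ⧸ M)) := by
    clear hsep hMS
    induction l with
    | nil => simp [altProd, altWord, ← FreeGroup.one_eq_mk]
    | cons p l ih =>
      simp only [List.forall_mem_cons] at hl
      rw [altProd, map_mul, map_mul, Equiv.Perm.mul_apply, Equiv.Perm.mul_apply, ih hl.2,
        hC' _ hl.1.2, hB' _ hl.1.1, ← QuotientGroup.mk_mul, FreeGroup.of_mul_of_inv, FreeGroup.mul_mk,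
        altWord, mul_assoc p.1]
      rfl
  refine ⟨h.ker, inferInstance, inferInstance, ?_⟩
  rintro ⟨-, ⟨b, hb, c, hc, rfl⟩, k, hk, hg⟩
  have hg' : h (c₀ * altProd l) (((1 : A) : A ⧸ N), 1) = h (b * c) (((1 : A) : A ⧸ N), 1) := by
    rw [← hg]
    simp only [map_mul, MonoidHom.mem_ker.1 hk, mul_one]
  rw [map_mul, map_mul, Equiv.Perm.mul_apply, Equiv.Perm.mul_apply, hword, hC' _ hc₀,
    hC' _ (hY hc), hB' _ (hX hb), mul_one, mul_one, Prod.mk.injEq] at hg'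
  exact hsep b hb c hc hg'.1 (hMS (e (b * c), e c) trivial (QuotientGroup.eq.1 hg'.2.symm))

/-- The case of an element of `B * C`. -/
theorem IsAmalgam.exists_separating_of_mem_mul {A : Type u} [Group A] {B C : Subgroup A}
    (hAm : IsAmalgam B C) {U V : Set A} (hU : U ⊆ (B : Set A)) (hV : V ⊆ (C : Set A))
    (hUD : SepSubset (U * ((B ⊓ C : Subgroup A) : Set A)))
    (hDV : SepSubset (((B ⊓ C : Subgroup A) : Set A) * V)) {b c : A} (hb : b ∈ B) (hc : c ∈ C)
    (hg : b * c ∉ U * ((B ⊓ C : Subgroup A) : Set A) * V) :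
    ∃ K : Subgroup A, K.Normal ∧ K.FiniteIndex ∧
      b * c ∉ U * ((B ⊓ C : Subgroup A) : Set A) * V * (K : Set A) := by
  have hX : U * ((B ⊓ C : Subgroup A) : Set A) ⊆ B := by
    rintro _ ⟨u, hu, d, hd, rfl⟩
    exact B.mul_mem (hU hu) hd.1
  have hN : ∃ N : Subgroup A, N.Normal ∧ N.FiniteIndex ∧
      (b ∉ U * ((B ⊓ C : Subgroup A) : Set A) * (N : Set A) ∨
        c ∉ ((B ⊓ C : Subgroup A) : Set A) * V * (N : Set A)) := by
    by_cases hbU : b ∈ U * ((B ⊓ C : Subgroup A) : Set A)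
    · by_cases hcV : c ∈ ((B ⊓ C : Subgroup A) : Set A) * V
      · obtain ⟨u, hu, d, hd, rfl⟩ := hbU
        obtain ⟨d', hd', v, hv, rfl⟩ := hcV
        refine absurd ⟨_, ⟨u, hu, d * d', (B ⊓ C).mul_mem hd hd', rfl⟩, v, hv, ?_⟩ hg
        simp [mul_assoc]
      · obtain ⟨N, h, h', hN⟩ := hDV c hcV
        exact ⟨N, h, h', Or.inr hN⟩
    · obtain ⟨N, h, h', hN⟩ := hUD b hbU
      exact ⟨N, h, h', Or.inl hN⟩
  obtain ⟨N, _, _, hN⟩ := hN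
  have := hAm.exists_separating hX hV N C.one_mem (l := [(b, c)]) (by simp [hb, hc]) (by
    rintro b' hb' v hv hq hW
    have hq' : (b : A ⧸ N) * c = b' * v := by
      simpa [altProd] using hq
    have hlab : orbitLabel B C N (b * c) = orbitLabel B C N (b' * v) := by
      have : ((b * c : A) : A ⧸ N) = (b' * v : A) := hq'
      rw [orbitLabel, orbitLabel, this]
    have hW' : FreeGroup.mk (altWord (orbitLabel B C N) [(b, c)]) =
        FreeGroup.of (orbitLabel B C N (b * c)) * (FreeGroup.of (orbitLabel B C N c))⁻¹ := by
      simp only [altWord, altProd, mul_one, FreeGroup.of_mul_of_inv]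
    rw [hW', hlab, mul_right_inj, inv_inj] at hW
    obtain ⟨d, hd, hdc⟩ := orbitLabel_eq_iff.1 (FreeGroup.of_injective hW)
    rw [mem_mul_iff_exists_mk_eq, mem_mul_iff_exists_mk_eq] at hN
    refine hN.elim (fun hN => hN ?_) fun hN => hN ⟨d * v, ⟨d, hd, v, hv, rfl⟩, hdc⟩
    obtain ⟨u, hu, d', hd', rfl⟩ := hb'
    refine ⟨u * (d' * d⁻¹), ⟨u, hu, _, (B ⊓ C).mul_mem hd' ((B ⊓ C).inv_mem hd), rfl⟩, ?_⟩
    rw [← hdc] at hq'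
    simp only [QuotientGroup.mk_mul, QuotientGroup.mk_inv] at hq' ⊢
    rw [← mul_assoc (b : A ⧸ N)] at hq'
    rw [← mul_assoc, ← mul_right_cancel hq', mul_inv_cancel_right])
  simpa [altProd] using this

/-- The case of an element outside `B * C`. -/
theorem IsAmalgam.exists_separating_of_notMem_mul {A : Type u} [Group A] {B C : Subgroup A}
    (hAm : IsAmalgam B C) (hD : SepSubset ((B ⊓ C : Subgroup A) : Set A)) {X Y : Set A}
    (hX : X ⊆ B) (hY : Y ⊆ C) {g : A} (hg : g ∉ (B : Set A) * (C : Set A)) :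
    ∃ K : Subgroup A, K.Normal ∧ K.FiniteIndex ∧ g ∉ X * Y * (K : Set A) := by
  classical
  obtain ⟨c₀, hc₀, l, hl, h1, h2, rfl⟩ := hasAltForm_of_sup_eq_top hAm.1 g
  obtain ⟨N, _, _, hN⟩ := exists_finiteIndex_forall_mem (G := A)
    (S := {x | x ∈ c₀ :: (l.map Prod.fst ++ l.map Prod.snd)}) (List.finite_toSet _)
    (fun x N => x ∈ ((B ⊓ C : Subgroup A) : Set A) * (N : Set A) → x ∈ B ⊓ C)
    (fun x N N' hle h hx => h (Set.mul_subset_mul_left hle hx)) (by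
      intro x _
      by_cases hx : x ∈ B ⊓ C
      · exact ⟨⊤, inferInstance, inferInstance, fun _ => hx⟩
      · obtain ⟨N, h, h', hN⟩ := hD x hx
        exact ⟨N, h, h', fun h => absurd h hN⟩)
  have hred : FreeGroup.IsReduced (altWord (orbitLabel B C N) l) := by
    refine altWord_isReduced _ (fun x => x ∈ ((B ⊓ C : Subgroup A) : Set A) * (N : Set A))
      (fun a x h => orbitLabel_mul_eq_imp h) l (fun p hp h => h1 p hp (hN p.1 ?_ h)) ?_
    · simp only [Set.mem_ofPred_eq, List.mem_cons, List.mem_append]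
      exact Or.inr (Or.inl (List.mem_map_of_mem hp))
    · refine h2.imp_of_mem_imp fun p q hp _ h h' => h (hN p.2 ?_ h')
      simp only [Set.mem_ofPred_eq, List.mem_cons, List.mem_append]
      exact Or.inr (Or.inr (List.mem_map_of_mem hp))
  refine hAm.exists_separating hX hY N hc₀ hl fun b hb c hc hq hW => ?_
  have hlen : 2 * l.length ≤ 2 := by
    have hn := FreeGroup.norm_mul_le (FreeGroup.of (orbitLabel B C N (b * c)))
      (FreeGroup.of (orbitLabel B C N c))⁻¹
    rw [← hW, FreeGroup.norm, FreeGroup.toWord_mk, hred.reduce_eq, altWord_length,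
      FreeGroup.norm_inv_eq, FreeGroup.norm_of, FreeGroup.norm_of] at hn
    exact hn
  match l, hlen with
  | [], _ => exact hg ⟨1, B.one_mem, c₀, hc₀, by simp [altProd]⟩
  | [(b₁, c₁)], _ =>
    have hm := hl (b₁, c₁) (by simp)
    have hc₀D : c₀ ∉ B ⊓ C := fun h =>
      hg ⟨c₀ * b₁, B.mul_mem h.1 hm.1, c₁, hm.2, by simp [altProd, mul_assoc]⟩
    refine hc₀D (hN c₀ (by simp) (orbitLabel_mul_eq_imp (x := altProd [(b₁, c₁)]) ?_))
    have hlab : orbitLabel B C N (c₀ * altProd [(b₁, c₁)]) = orbitLabel B C N (b * c) := by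
      rw [orbitLabel, orbitLabel, hq]
    rw [hlab]
    have hne : orbitLabel B C N (b * c) ≠ orbitLabel B C N c := by
      intro h
      rw [h, mul_inv_cancel, ← FreeGroup.toWord_eq_nil_iff, FreeGroup.toWord_mk,
        hred.reduce_eq] at hW
      exact absurd (congrArg List.length hW) (by simp [altWord])
    have hRred : FreeGroup.IsReduced
        [(orbitLabel B C N (b * c), true), (orbitLabel B C N c, false)] := by
      simp [hne]
    rw [FreeGroup.of_mul_of_inv] at hW
    have hlist := FreeGroup.reduce.sound hW
    rw [hred.reduce_eq, hRred.reduce_eq] at hlist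
    simp only [altWord, List.cons.injEq, Prod.mk.injEq] at hlist
    rw [← hlist.1.1, ← mul_assoc]
    rfl
  | _ :: _ :: _, h => simp at h

/-- In an amalgamated free product `A = B *_D C` with `D = B ∩ C`, if `U ⊆ B`, `V ⊆ C`
and the products `UD` and `DV` are separable in `A`, then the triple product `UDV`
is separable in `A`. -/
theorem stmt_11 {A : Type u} [Group A] (B C : Subgroup A) (hAm : IsAmalgam B C)
    (U V : Set A) (hU : U ⊆ (B : Set A)) (hV : V ⊆ (C : Set A))
    (hUD : SepSubset (U * ((B ⊓ C : Subgroup A) : Set A)))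
    (hDV : SepSubset (((B ⊓ C : Subgroup A) : Set A) * V)) :
    SepSubset (U * ((B ⊓ C : Subgroup A) : Set A) * V) := by
  intro g hg
  rcases U.eq_empty_or_nonempty with rfl | ⟨u, hu⟩
  · exact ⟨⊤, inferInstance, inferInstance, by simp⟩
  rcases V.eq_empty_or_nonempty with rfl | ⟨v, hv⟩
  · exact ⟨⊤, inferInstance, inferInstance, by simp⟩
  by_cases hgBC : g ∈ (B : Set A) * (C : Set A)
  · obtain ⟨b, hb, c, hc, rfl⟩ := hgBC
    exact hAm.exists_separating_of_mem_mul hU hV hUD hDV hb hc hg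
  refine hAm.exists_separating_of_notMem_mul ?_ ?_ hV hgBC
  · intro x hx
    by_cases hxU : u * x ∈ U * ((B ⊓ C : Subgroup A) : Set A)
    · by_cases hxV : x * v ∈ ((B ⊓ C : Subgroup A) : Set A) * V
      · refine absurd ⟨?_, ?_⟩ hx
        · obtain ⟨u', hu', d, hd, h⟩ := hxU
          change x ∈ B
          rw [← B.mul_mem_cancel_left (hU hu), ← h]
          exact B.mul_mem (hU hu') hd.1
        · obtain ⟨d, hd, v', hv', h⟩ := hxV
          change x ∈ C
          rw [← C.mul_mem_cancel_right (hV hv), ← h]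
          exact C.mul_mem hd.2 (hV hv')
      · obtain ⟨N, h, h', hN⟩ := hDV _ hxV
        refine ⟨N, h, h', fun hxN => hN ?_⟩
        obtain ⟨d, hd, n, hn, rfl⟩ := hxN
        refine ⟨d * v, ⟨d, hd, v, hv, rfl⟩, v⁻¹ * n * v, ?_, by group⟩
        simpa using h.conj_mem n hn v⁻¹
    · obtain ⟨N, h, h', hN⟩ := hUD _ hxU
      refine ⟨N, h, h', fun hxN => hN ?_⟩
      obtain ⟨d, hd, n, hn, rfl⟩ := hxN
      exact ⟨u * d, ⟨u, hu, d, hd, rfl⟩, n, hn, by group⟩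
  · rintro _ ⟨u, hu, d, hd, rfl⟩
    exact B.mul_mem (hU hu) hd.1
end

section
/- Let G be a group generated by a finite set X, let m ∈ ℕ₀ and let Q, R, T_1, …, T_m ≤ G be subgroups; set S = Q ∩ R. Suppose the product RT_1⋯T_l is separable in G for each l = 0, …, m (for l = 0 this product is the subgroup R). Then for every constant B ≥ 0 there exists a finite index subgroup N ≤_f G with S ⊆ N such that arbitrary subgroups Q' ≤ Q ∩ N and R' ≤ R ∩ N satisfy: for each j = 0, …, m, every element of R⟨Q', R'⟩RT_1⋯T_j ∖ RT_1⋯T_j has word length at least B with respect to X. -/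
open Pointwise

/-- An element of a group generated by `X` is a product of `wordLength X g` elements of
`X ∪ X⁻¹`. -/
theorem mem_pow_wordLength {G : Type*} [Group G] {X : Set G}
    (hX : Subgroup.closure X = ⊤) (g : G) : g ∈ (X ∪ X⁻¹) ^ wordLength X g := by
  have hne : {n : ℕ | ∃ l : List G, l.length = n ∧ (∀ x ∈ l, x ∈ X ∪ X⁻¹) ∧
      l.prod = g}.Nonempty := by
    obtain ⟨l, hl, hlg⟩ := Submonoid.exists_list_of_mem_closure
      (show g ∈ Submonoid.closure (X ∪ X⁻¹) by
        rw [← Subgroup.closure_toSubmonoid, hX]; trivial)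
    exact ⟨l.length, l, rfl, hl, hlg⟩
  obtain ⟨l, hlen, hl, hlg⟩ := Nat.sInf_mem hne
  have key : ∀ l : List G, (∀ x ∈ l, x ∈ X ∪ X⁻¹) → l.prod ∈ (X ∪ X⁻¹) ^ l.length := by
    intro l
    induction l with
    | nil => simp
    | cons a l ih =>
      intro h
      rw [List.prod_cons, List.length_cons, pow_succ']
      exact Set.mul_mem_mul (h a (by simp)) (ih fun x hx => h x (by simp [hx]))
  have := key l hl
  rwa [hlen, hlg] at this

/-- Balls in the word metric of a finite generating set are finite. -/
theorem finite_wordLength_lt {G : Type*} [Group G] {X : Set G} (hXfin : X.Finite)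
    (hX : Subgroup.closure X = ⊤) (B : ℝ) : {g : G | (wordLength X g : ℝ) < B}.Finite := by
  have hpow : ∀ k : ℕ, ((X ∪ X⁻¹) ^ k).Finite := by
    intro k
    induction k with
    | zero => simp
    | succ k ih => exact pow_succ (X ∪ X⁻¹) k ▸ ih.mul (hXfin.union hXfin.inv)
  refine ((Set.finite_lt_nat ⌈B⌉₊).biUnion fun k _ => hpow k).subset fun g hg => ?_
  exact Set.mem_biUnion (x := wordLength X g) (Nat.lt_ceil.2 hg) (mem_pow_wordLength hX g)

/-- Finitely many non-memberships in separable sets are witnessed by a single finite index normal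
subgroup. -/
theorem exists_normal_finiteIndex_forall_notMem_mul {G ι : Type*} [Group G] [Finite ι]
    (Z : ι → Set G) (hZ : ∀ i, SepSubset (Z i)) (g : ι → G) (hg : ∀ i, g i ∉ Z i) :
    ∃ M : Subgroup G, M.Normal ∧ M.FiniteIndex ∧ ∀ i, g i ∉ Z i * (M : Set G) := by
  choose N hnormal hindex hN using fun i => hZ i (g i) (hg i)
  exact ⟨⨅ i, N i, Subgroup.normal_iInf_normal hnormal, Subgroup.finiteIndex_iInf hindex,
    fun i hi => hN i (Set.mul_subset_mul_left (iInf_le N i) hi)⟩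

/-- Lemma 12.1: separability of the products `R T_1 ⋯ T_l` (`l = 0, …, m`) yields a finite
index subgroup `N ≤_f G` containing `S = Q ⊓ R` realising condition (C2-m).
Here the subgroups `T_1, …, T_m` are encoded as `T 0, …, T (m-1)`, and
`T_1 ⋯ T_l` is `((List.range l).map fun i => (T i : Set G)).prod`. -/
theorem stmt_15 {G : Type*} [Group G] (X : Set G) (hXfin : X.Finite)
    (hXgen : Subgroup.closure X = ⊤) (m : ℕ) (Q R : Subgroup G) (T : ℕ → Subgroup G)
    (hsep : ∀ l ≤ m,
      SepSubset ((R : Set G) * ((List.range l).map fun i => ((T i : Subgroup G) : Set G)).prod))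
    (B : ℝ) (hB : 0 ≤ B) :
    ∃ N : Subgroup G, N.FiniteIndex ∧ Q ⊓ R ≤ N ∧
      ∀ Q' R' : Subgroup G, Q' ≤ Q ⊓ N → R' ≤ R ⊓ N →
        ∀ j ≤ m,
          ∀ g ∈ ((R : Set G) * (↑(Q' ⊔ R') : Set G) * (R : Set G) *
              ((List.range j).map fun i => ((T i : Subgroup G) : Set G)).prod) \
            ((R : Set G) * ((List.range j).map fun i => ((T i : Subgroup G) : Set G)).prod),
          B ≤ (wordLength X g : ℝ) := by
  let Z : ℕ → Set G := fun j =>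
    (R : Set G) * ((List.range j).map fun i => ((T i : Subgroup G) : Set G)).prod
  have hF : {p : G × ℕ | ((wordLength X p.1 : ℝ) < B ∧ p.2 ≤ m) ∧ p.1 ∉ Z p.2}.Finite :=
    ((finite_wordLength_lt hXfin hXgen B).prod (Set.finite_le_nat m)).subset fun p hp => hp.1
  have := hF.to_subtype
  obtain ⟨M, hM, hMindex, hMZ⟩ := exists_normal_finiteIndex_forall_notMem_mul
    (ι := {p : G × ℕ | ((wordLength X p.1 : ℝ) < B ∧ p.2 ≤ m) ∧ p.1 ∉ Z p.2})
    (fun p => Z p.1.2) (fun p => hsep _ p.2.1.2) (fun p => p.1.1) (fun p => p.2.2)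
  refine ⟨R ⊔ M, Subgroup.finiteIndex_of_le le_sup_right, inf_le_right.trans le_sup_left, ?_⟩
  rintro Q' R' hQ' hR' j hj g ⟨hg, hgZ⟩
  by_contra! hlt
  refine hMZ ⟨(g, j), ⟨hlt, hj⟩, hgZ⟩ ?_
  obtain ⟨a, ha, t, ht, rfl⟩ := hg
  obtain ⟨b, hb, r, hr, rfl⟩ := ha
  obtain ⟨r', hr', q, hq, rfl⟩ := hb
  have hle : R ≤ R ⊔ M := le_sup_left
  have hq' : q ∈ R ⊔ M :=
    sup_le (hQ'.trans inf_le_right) (hR'.trans inf_le_right) hq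
  obtain ⟨u, hu, v, hv, huv⟩ := Subgroup.mem_sup_of_normal_right.1
    (mul_mem (mul_mem (hle hr') hq') (hle hr))
  refine ⟨u * t, Set.mul_mem_mul hu ht, t⁻¹ * v * t, ?_, ?_⟩
  · simpa using hM.conj_mem v hv t⁻¹
  · simp only [← huv]
    group
end

section
/- Let N be a group, let n ≥ 2 be an integer, and let H_1, …, H_n be subgroups of N such that, for some i ∈ {1, …, n}, the subgroup H_i is normal in N and the image of the product H_1⋯H_{i-1}H_{i+1}⋯H_n under the quotient homomorphism N → N/H_i is separable in N/H_i. Then the product H_1⋯H_n is separable in N. -/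
open Pointwise

/-- The preimage of a separable set under a group homomorphism is separable. -/
theorem SepSubset.preimage {G G' : Type*} [Group G] [Group G'] {Z : Set G'} (hZ : SepSubset Z)
    (f : G →* G') : SepSubset (f ⁻¹' Z) := by
  intro g hg
  obtain ⟨M, hM, hfin, hgM⟩ := hZ (f g) hg
  refine ⟨M.comap f, inferInstance, ⟨?_⟩, ?_⟩
  · rw [Subgroup.index_comap]
    exact Subgroup.FiniteIndex.index_ne_zero
  rintro ⟨z, hz, m, hm, rfl⟩
  exact hgM ⟨f z, hz, f m, hm, (map_mul f z m).symm⟩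

/-- Modulo a normal factor, that factor can be dropped from a product of subgroups. -/
theorem prod_map_filter_ne_mul_normal {G ι : Type*} [Group G] [DecidableEq ι]
    (H : ι → Subgroup G) (i : ι) [(H i).Normal] (l : List ι) :
    ((l.filter (fun j => j ≠ i)).map (fun j => (H j : Set G))).prod * (H i : Set G) =
      (l.map (fun j => (H j : Set G))).prod * (H i : Set G) := by
  induction l with
  | nil => rfl
  | cons j t ih =>
    by_cases hj : j = i
    · subst hj
      rw [List.filter_cons_of_neg (by simp), ih, List.map_cons, List.prod_cons,
        ← Subgroup.set_mul_normal_comm, mul_assoc, coe_mul_coe]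
    · rw [List.filter_cons_of_pos (by simpa using hj), List.map_cons, List.prod_cons, mul_assoc,
        ih, List.map_cons, List.prod_cons, mul_assoc]

/-- A product of subgroups absorbs each of its normal factors. -/
theorem prod_map_mul_normal_of_mem {G ι : Type*} [Group G] (H : ι → Subgroup G) (i : ι)
    [(H i).Normal] {l : List ι} (hi : i ∈ l) :
    (l.map (fun j => (H j : Set G))).prod * (H i : Set G) =
      (l.map (fun j => (H j : Set G))).prod := by
  obtain ⟨s, t, rfl⟩ := List.append_of_mem hi
  rw [List.map_append, List.prod_append, List.map_cons, List.prod_cons, mul_assoc,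
    ← Subgroup.set_mul_normal_comm, mul_assoc, coe_mul_coe]

/-- Lemma 14.2: if `H i ⊴ N` and the image of `H_1 ⋯ H_{i-1} H_{i+1} ⋯ H_n` in `N/H_i` is
separable in `N/H_i`, then `H_1 ⋯ H_n` is separable in `N`. -/
theorem stmt_17 {N : Type*} [Group N] (n : ℕ) (hn : 2 ≤ n) (H : Fin n → Subgroup N)
    (i : Fin n) [hnorm : (H i).Normal]
    (hsep : SepSubset ((QuotientGroup.mk' (H i)) ''
      ((((List.finRange n).filter (fun j => j ≠ i)).map
        (fun j => ((H j : Subgroup N) : Set N))).prod))) :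
    SepSubset (((List.finRange n).map (fun j => ((H j : Subgroup N) : Set N))).prod) := by
  rw [← prod_map_mul_normal_of_mem H i (List.mem_finRange i), ← prod_map_filter_ne_mul_normal,
    ← QuotientGroup.preimage_image_mk_eq_mul]
  exact hsep.preimage (QuotientGroup.mk' (H i))
end
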